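/- Let Ω be an open convex proper subset of ℝⁿ with finite inner radius δ₀ = sup_{x∈Ω} dist(x, ∂Ω). Let m > 1, ν ∈ (0, 1/m], λ ∈ [0, (1 + νm)/2), and let c > 0 satisfy (1 − 2λ)·J_ν(2c/m) + 2c·J′_ν(2c/m) = 0 with 2c/m ∈ (0, j_ν). Then for every f ∈ C₀¹(Ω) with |∇f|/δ ∈ L¹(Ω): ((1 − ν²m²)/4)·∫_Ω |f(x)|/δ(x)² dx + ((c² + (m − 1)(λ − λ²))/δ₀^m)·∫_Ω |f(x)|/δ(x)^{2−m} dx ≤ ((1 + νm)/2 − λ²)·∫_Ω |∇f(x)|/δ(x) dx. -/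

import Mathlib

open MeasureTheory Real Set Filter

/-- Bessel function of the first kind of real order `ν`, defined for `x > 0` by its series. -/
noncomputable def besselJ (ν x : ℝ) : ℝ :=
  ∑' k : ℕ, (-1 : ℝ) ^ k * x ^ (2 * (k : ℝ) + ν) /
    (2 ^ (2 * (k : ℝ) + ν) * (Nat.factorial k : ℝ) * Real.Gamma ((k : ℝ) + 1 + ν))

section NormedSpaceLemmas

open scoped Topology NNReal

variable {E : Type*} [NormedAddCommGroup E]

lemma LipschitzWith.exists_lipschitzWith_mul {u w : E → ℝ} {A B : ℝ≥0} {M N : ℝ}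
    (hu : LipschitzWith A u) (hw : LipschitzWith B w) (hM : ∀ x, |u x| ≤ M)
    (hN : ∀ x, u x ≠ 0 → |w x| ≤ N) : ∃ C : ℝ≥0, LipschitzWith C fun x => u x * w x := by
  by_cases hu0 : ∀ x, u x = 0
  · refine ⟨0, ?_⟩
    simp only [hu0, zero_mul]
    exact LipschitzWith.const 0
  push Not at hu0
  obtain ⟨x₀, hx₀⟩ := hu0
  have hM0 : 0 ≤ M := (abs_nonneg _).trans (hM x₀)
  have hN0 : 0 ≤ N := (abs_nonneg _).trans (hN x₀ hx₀)
  have main : ∀ x y, u x ≠ 0 → |u x * w x - u y * w y| ≤ (M * B + A * N) * dist x y := by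
    intro x y hx
    have h1 := hu.dist_le_mul x y
    have h2 := hw.dist_le_mul x y
    rw [Real.dist_eq] at h1 h2
    calc |u x * w x - u y * w y| = |u y * (w x - w y) + (u x - u y) * w x| := by ring_nf
      _ ≤ |u y| * |w x - w y| + |u x - u y| * |w x| := by
        rw [← abs_mul, ← abs_mul]; exact abs_add_le _ _
      _ ≤ M * (B * dist x y) + (A * dist x y) * N := by
        gcongr
        · exact hM y
        · exact hN x hx
      _ = _ := by ring
  refine ⟨⟨M * B + A * N, by positivity⟩, LipschitzWith.of_dist_le_mul fun x y => ?_⟩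
  rw [Real.dist_eq]
  change _ ≤ (M * B + A * N) * dist x y
  by_cases hx : u x = 0
  · by_cases hy : u y = 0
    · simp only [hx, hy, zero_mul, sub_self, abs_zero]
      positivity
    · rw [abs_sub_comm, dist_comm]
      exact main y x hy
  · exact main x y hx

section

variable [NormedSpace ℝ E]

lemma frontier_nonempty_of_ne_univ {Ω : Set E} (hΩne : Ω.Nonempty) (hne : Ω ≠ univ) :
    (frontier Ω).Nonempty :=
  nonempty_frontier_iff.2 ⟨hΩne, hne⟩

lemma infDist_frontier_pos {Ω : Set E} (hΩ : IsOpen Ω) (hne : Ω ≠ univ) {x : E} (hx : x ∈ Ω) :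
    0 < Metric.infDist x (frontier Ω) := by
  rw [← isClosed_frontier.notMem_iff_infDist_pos (frontier_nonempty_of_ne_univ ⟨x, hx⟩ hne)]
  intro h
  exact (disjoint_frontier_iff_isOpen.2 hΩ).le_bot ⟨h, hx⟩

lemma LipschitzWith.norm_inv_smul_sub_le {d : E → ℝ} {C : ℝ≥0} (hd : LipschitzWith C d) {t : ℝ}
    (ht : 0 < t) (x v : E) : ‖t⁻¹ • (d (x + t • v) - d x)‖ ≤ C * ‖v‖ := by
  have h := hd.norm_sub_le (x + t • v) x
  rw [add_sub_cancel_left, norm_smul, Real.norm_of_nonneg ht.le] at h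
  rw [norm_smul, norm_inv, Real.norm_of_nonneg ht.le, inv_mul_le_iff₀ ht]
  linarith

lemma lineDeriv_eq_zero_of_notMem_tsupport {g : E → ℝ} {x : E} (hx : x ∉ tsupport g) (v : E) :
    lineDeriv ℝ g x v = 0 := by
  have h : g =ᶠ[𝓝 x] fun _ => 0 := notMem_tsupport_iff_eventuallyEq.1 hx
  rw [h.lineDeriv_eq]
  simp [lineDeriv]

lemma norm_fderiv_abs_le {f : E → ℝ} {x : E} (hf : DifferentiableAt ℝ f x) :
    ‖fderiv ℝ (fun y => |f y|) x‖ ≤ ‖fderiv ℝ f x‖ := by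
  rcases lt_trichotomy (f x) 0 with h | h | h
  · have : (fun y => |f y|) =ᶠ[𝓝 x] fun y => -f y := by
      filter_upwards [hf.continuousAt.eventually (gt_mem_nhds h)] with y hy using abs_of_neg hy
    rw [this.fderiv_eq, fderiv_fun_neg, norm_neg]
  · have : IsLocalMin (fun y => |f y|) x := Filter.Eventually.of_forall fun y => by simp [h]
    rw [this.fderiv_eq_zero, norm_zero]
    exact norm_nonneg _
  · have : (fun y => |f y|) =ᶠ[𝓝 x] f := by
      filter_upwards [hf.continuousAt.eventually (lt_mem_nhds h)] with y hy using abs_of_pos hy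
    rw [this.fderiv_eq]

end

section

variable [MeasurableSpace E] [BorelSpace E] {μ : Measure E} [μ.IsAddHaarMeasure]

lemma integral_diffQuot_mul_diffQuot_eq {d g : E → ℝ} (hd : Continuous d) (hg : Continuous g)
    (hgc : HasCompactSupport g) (w : E) :
    ∫ x, (g (x + w) - g x) * (d (x + w) - d x) ∂μ
      = ∫ x, g x * (2 * d x - d (x - w) - d (x + w)) ∂μ := by
  have hgc' : HasCompactSupport fun x => g (x + w) :=
    hgc.comp_homeomorph (Homeomorph.addRight w)
  have hT : ∫ x, g (x + w) * (d (x + w) - d x) ∂μ = ∫ x, g x * (d x - d (x - w)) ∂μ := by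
    rw [← integral_add_right_eq_self (fun x => g x * (d x - d (x - w))) w]
    simp
  simp_rw [sub_mul]
  rw [integral_sub, hT, ← integral_sub]
  · congr 1 with x
    ring
  · exact Continuous.integrable_of_hasCompactSupport (by fun_prop) hgc.mul_right
  · exact Continuous.integrable_of_hasCompactSupport (by fun_prop) hgc.mul_right
  · exact Continuous.integrable_of_hasCompactSupport (by fun_prop) hgc'.mul_right
  · exact Continuous.integrable_of_hasCompactSupport (by fun_prop) hgc.mul_right

lemma integrable_of_continuousOn_tsupport {f F : E → ℝ} (hf : HasCompactSupport f)
    (hF : ContinuousOn F (tsupport f)) (h0 : ∀ x ∉ tsupport f, F x = 0) : Integrable F μ :=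
  (integrableOn_iff_integrable_of_support_subset fun x hx => by
    by_contra h
    exact hx (h0 x h)).1 (hF.integrableOn_compact hf)

end

end NormedSpaceLemmas

section Domain

variable {E : Type*} [NormedAddCommGroup E] [InnerProductSpace ℝ E] [FiniteDimensional ℝ E]
  {Ω : Set E}

lemma ball_infDist_frontier_subset (hne : Ω ≠ univ) {x : E} (hx : x ∈ Ω) :
    Metric.ball x (Metric.infDist x (frontier Ω)) ⊆ Ω := by
  obtain ⟨y, hy, hxy⟩ := exists_mem_frontier_infDist_compl_eq_dist hx hne
  refine (Metric.ball_subset_ball ?_).trans Metric.ball_infDist_compl_subset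
  rw [hxy]
  exact Metric.infDist_le_dist_of_mem hy

lemma OrthonormalBasis.sum_apply_mul_apply {ι : Type*} [Fintype ι] (b : OrthonormalBasis ι ℝ E)
    (L M : E →L[ℝ] ℝ) :
    ∑ i, L (b i) * M (b i) = inner ℝ ((InnerProductSpace.toDual ℝ E).symm L)
      ((InnerProductSpace.toDual ℝ E).symm M) := by
  rw [← b.sum_inner_mul_inner]
  refine Finset.sum_congr rfl fun i _ => ?_
  rw [InnerProductSpace.toDual_symm_apply, real_inner_comm, InnerProductSpace.toDual_symm_apply]

/-- The distance to the boundary of a convex open set is concave on that set. -/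
lemma concaveOn_infDist_frontier (hΩ : IsOpen Ω) (hconv : Convex ℝ Ω) (hne : Ω ≠ univ) :
    ConcaveOn ℝ Ω (fun x => Metric.infDist x (frontier Ω)) := by
  refine ⟨hconv, fun x hx y hy a b ha hb hab => ?_⟩
  have hdx := infDist_frontier_pos hΩ hne hx
  have hdy := infDist_frontier_pos hΩ hne hy
  have hbx := ball_infDist_frontier_subset hne hx
  have hby := ball_infDist_frontier_subset hne hy
  simp only [smul_eq_mul]
  set dx := Metric.infDist x (frontier Ω)
  set dy := Metric.infDist y (frontier Ω)
  rw [Metric.le_infDist (frontier_nonempty_of_ne_univ ⟨x, hx⟩ hne)]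
  intro z hz
  by_contra! hlt
  have hzΩ : z ∉ Ω := fun h => (disjoint_frontier_iff_isOpen.2 hΩ).le_bot ⟨hz, h⟩
  set r := a * dx + b * dy with hr
  have hr0 : 0 < r := dist_nonneg.trans_lt hlt
  set u := z - (a • x + b • y) with hu
  have hur : ‖u‖ < r := by rwa [dist_comm, dist_eq_norm] at hlt
  have key : ∀ (w : E) (d : ℝ), 0 < d → w + (d / r) • u ∈ Metric.ball w d := by
    intro w d hd
    rw [mem_ball_iff_norm, add_sub_cancel_left, norm_smul, Real.norm_of_nonneg (by positivity),
      div_mul_eq_mul_div, div_lt_iff₀ hr0]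
    gcongr
  apply hzΩ
  have := hconv (hbx (key x dx hdx)) (hby (key y dy hdy)) ha hb hab
  convert this using 1
  have h1 : a * (dx / r) + b * (dy / r) = 1 := by
    field_simp
    exact hr.symm
  calc z = (a • x + b • y) + (1 : ℝ) • u := by simp [hu]
    _ = _ := by rw [← h1]; module

/-- Where it is differentiable, the distance to the boundary has gradient of norm at least `1`. -/
lemma one_le_norm_fderiv_infDist_frontier (hΩ : IsOpen Ω) (hne : Ω ≠ univ) {x : E} (hx : x ∈ Ω)
    (hd : DifferentiableAt ℝ (fun x => Metric.infDist x (frontier Ω)) x) :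
    1 ≤ ‖fderiv ℝ (fun x => Metric.infDist x (frontier Ω)) x‖ := by
  obtain ⟨y, hy, hxy⟩ := isClosed_frontier.exists_infDist_eq_dist
    (frontier_nonempty_of_ne_univ ⟨x, hx⟩ hne) x
  have hpos := infDist_frontier_pos hΩ hne hx
  have hlim := (hd.hasFDerivAt.hasLineDerivAt (y - x)).tendsto_slope_zero_right
  have hle : fderiv ℝ (fun x => Metric.infDist x (frontier Ω)) x (y - x) ≤ -dist x y := by
    refine le_of_tendsto hlim ?_
    filter_upwards [Ioc_mem_nhdsGT zero_lt_one] with t ht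
    have h1 : Metric.infDist (x + t • (y - x)) (frontier Ω) ≤ (1 - t) * dist x y := by
      refine (Metric.infDist_le_dist_of_mem hy).trans_eq ?_
      rw [dist_eq_norm, dist_eq_norm, show x + t • (y - x) - y = (1 - t) • (x - y) by module,
        norm_smul, Real.norm_of_nonneg (by linarith [ht.2])]
    rw [smul_eq_mul, inv_mul_le_iff₀ ht.1, hxy]
    linarith
  have h2 := (fderiv ℝ (fun x => Metric.infDist x (frontier Ω)) x).le_opNorm (y - x)
  rw [← dist_eq_norm, dist_comm] at h2
  rw [hxy] at hpos
  have h3 := neg_le_abs (fderiv ℝ (fun x => Metric.infDist x (frontier Ω)) x (y - x))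
  rw [← Real.norm_eq_abs] at h3
  refine le_of_mul_le_mul_right ?_ hpos
  linarith

end Domain

section Integral

variable {E : Type*} [NormedAddCommGroup E] [InnerProductSpace ℝ E] [FiniteDimensional ℝ E]
  [MeasurableSpace E] [BorelSpace E] {μ : Measure E} [μ.IsAddHaarMeasure]

open scoped Topology NNReal

/-- A Lipschitz function that is concave on `Ω` is weakly superharmonic in each direction there. -/
lemma ConcaveOn.integral_lineDeriv_mul_lineDeriv_nonneg {Ω : Set E} {d g : E → ℝ} {C D : ℝ≥0}
    (hΩ : IsOpen Ω) (hconc : ConcaveOn ℝ Ω d) (hd : LipschitzWith C d) (hg : LipschitzWith D g)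
    (hg0 : ∀ x, 0 ≤ g x) (hgc : HasCompactSupport g) (hgΩ : tsupport g ⊆ Ω) (v : E) :
    0 ≤ ∫ x, lineDeriv ℝ g x v * lineDeriv ℝ d x v ∂μ := by
  let K := Metric.cthickening ‖v‖ (tsupport g)
  have hK : IsCompact K := IsCompact.cthickening hgc
  have hlim : Tendsto (fun t : ℝ => ∫ x, (t⁻¹ • (g (x + t • v) - g x)) *
      (t⁻¹ • (d (x + t • v) - d x)) ∂μ) (𝓝[>] 0)
      (𝓝 (∫ x, lineDeriv ℝ g x v * lineDeriv ℝ d x v ∂μ)) := by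
    apply tendsto_integral_filter_of_dominated_convergence
      (K.indicator (fun _ => (D * ‖v‖) * (C * ‖v‖)))
    · filter_upwards with t
      have := hg.continuous
      have := hd.continuous
      exact Continuous.aestronglyMeasurable (by fun_prop)
    · filter_upwards [Ioc_mem_nhdsGT zero_lt_one] with t ht
      filter_upwards with x
      by_cases hx : x ∈ K
      · rw [indicator_of_mem hx, norm_mul]
        gcongr
        · exact hg.norm_inv_smul_sub_le ht.1 x v
        · exact hd.norm_inv_smul_sub_le ht.1 x v
      · have A : g x = 0 := by
          rw [← Function.notMem_support]
          contrapose hx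
          exact Metric.self_subset_cthickening _ (subset_tsupport _ hx)
        have B : g (x + t • v) = 0 := by
          rw [← Function.notMem_support]
          contrapose hx
          apply Metric.mem_cthickening_of_dist_le _ _ ‖v‖ (tsupport g) (subset_tsupport _ hx)
          simp only [dist_eq_norm, sub_add_cancel_left, norm_neg, norm_smul, Real.norm_eq_abs,
            abs_of_nonneg ht.1.le]
          exact mul_le_of_le_one_left (norm_nonneg v) ht.2
        rw [indicator_of_notMem hx]
        simp [A, B]
    · rw [integrable_indicator_iff hK.measurableSet]
      exact continuousOn_const.integrableOn_compact hK
    · filter_upwards [hg.ae_lineDifferentiableAt v, hd.ae_lineDifferentiableAt v] with x hx hx'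
      exact hx.hasLineDerivAt.tendsto_slope_zero_right.mul
        hx'.hasLineDerivAt.tendsto_slope_zero_right
  refine ge_of_tendsto hlim ?_
  obtain ⟨ε, hε, hεΩ⟩ := hgc.exists_cthickening_subset_open hΩ hgΩ
  have hsmall : ∀ᶠ t : ℝ in 𝓝[>] 0, ‖t • v‖ ≤ ε := by
    have : Tendsto (fun t : ℝ => ‖t • v‖) (𝓝[>] 0) (𝓝 0) := by
      have h : Continuous fun t : ℝ => ‖t • v‖ := by fun_prop
      simpa using (h.tendsto 0).mono_left nhdsWithin_le_nhds
    exact (this.eventually (gt_mem_nhds hε)).mono fun _ h => h.le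
  filter_upwards [hsmall] with t ht
  simp only [smul_eq_mul]
  have hre : ∀ x, t⁻¹ * (g (x + t • v) - g x) * (t⁻¹ * (d (x + t • v) - d x))
      = (t⁻¹ * t⁻¹) * ((g (x + t • v) - g x) * (d (x + t • v) - d x)) := fun x => by ring
  simp_rw [hre]
  rw [integral_const_mul,
    integral_diffQuot_mul_diffQuot_eq hd.continuous hg.continuous hgc]
  refine mul_nonneg (mul_self_nonneg _) (integral_nonneg fun x => ?_)
  by_cases hx : x ∈ tsupport g
  · refine mul_nonneg (hg0 x) ?_
    have hp : x + t • v ∈ Ω := hεΩ (Metric.mem_cthickening_of_dist_le _ x _ _ hx (by simpa using ht))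
    have hm : x - t • v ∈ Ω := hεΩ (Metric.mem_cthickening_of_dist_le _ x _ _ hx (by
      simpa [dist_eq_norm] using ht))
    have := hconc.2 hp hm (show (0 : ℝ) ≤ 1 / 2 by norm_num) (show (0 : ℝ) ≤ 1 / 2 by norm_num)
      (by norm_num)
    rw [show (1 / 2 : ℝ) • (x + t • v) + (1 / 2 : ℝ) • (x - t • v) = x by module] at this
    simp only [smul_eq_mul] at this
    linarith
  · simp [image_eq_zero_of_notMem_tsupport hx]

lemma integrable_lineDeriv_mul_lineDeriv {d g : E → ℝ} {C D : ℝ≥0}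
    (hd : LipschitzWith C d) (hg : LipschitzWith D g) (hgc : HasCompactSupport g) (v : E) :
    Integrable (fun x => lineDeriv ℝ g x v * lineDeriv ℝ d x v) μ := by
  have h : MemLp (fun x => lineDeriv ℝ g x v * lineDeriv ℝ d x v) ⊤ μ :=
    (hd.memLp_lineDeriv v).mul (hg.memLp_lineDeriv v)
  refine (integrableOn_iff_integrable_of_support_subset (s := tsupport g) fun x hx => ?_).1
    ((h.locallyIntegrable le_top).integrableOn_isCompact hgc)
  by_contra hxt
  exact hx (by simp [lineDeriv_eq_zero_of_notMem_tsupport hxt])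

/-- A weighted `L¹` Hardy inequality on a convex domain, for a nonnegative weight profile
`φ` of the distance to the boundary. -/
lemma integral_abs_mul_neg_deriv_le {Ω : Set E} (hΩ : IsOpen Ω) (hconv : Convex ℝ Ω)
    (hne : Ω ≠ univ) {δ₀ R : ℝ} (hδ : ∀ x ∈ Ω, Metric.infDist x (frontier Ω) ≤ δ₀) (hR : δ₀ < R)
    {φ φ' : ℝ → ℝ} (hφ : ∀ t ∈ Ioo 0 R, HasDerivAt φ (φ' t) t)
    (hφ' : ContinuousOn φ' (Ioo 0 R)) (hφ0 : ∀ t ∈ Ioc 0 δ₀, 0 ≤ φ t)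
    {f : E → ℝ} (hf : ContDiff ℝ 1 f)
    (hsupp : HasCompactSupport f) (hsuppΩ : tsupport f ⊆ Ω) :
    ∫ x in Ω, |f x| * -φ' (Metric.infDist x (frontier Ω)) ∂μ
      ≤ ∫ x in Ω, ‖fderiv ℝ f x‖ * φ (Metric.infDist x (frontier Ω)) ∂μ := by
  set d : E → ℝ := fun x => Metric.infDist x (frontier Ω) with hd_def
  have hd : LipschitzWith 1 d := Metric.lipschitz_infDist_pt _
  have hdpos : ∀ x ∈ Ω, 0 < d x := fun x hx => infDist_frontier_pos hΩ hne hx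
  obtain ⟨a, ha, had⟩ := hsupp.exists_forall_le' hd.continuous.continuousOn
    (fun x hx => hdpos x (hsuppΩ hx))
  obtain ⟨b, hb, hbR⟩ := exists_between hR
  have hIcc : Icc (a / 2) b ⊆ Ioo 0 R := fun t ht =>
    ⟨by linarith [ht.1], by linarith [ht.2]⟩
  have hdI : ∀ x ∈ tsupport f, d x ∈ Ioo (a / 2) b := fun x hx =>
    ⟨by linarith [had x hx], by linarith [hδ x (hsuppΩ hx)]⟩
  have hdc : ∀ x ∈ tsupport f, d x ∈ Ioc 0 δ₀ := fun x hx =>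
    ⟨hdpos x (hsuppΩ hx), hδ x (hsuppΩ hx)⟩
  obtain ⟨L, hL⟩ := isCompact_Icc.exists_bound_of_continuousOn (hφ'.mono hIcc)
  have hφL : LipschitzOnWith (Real.toNNReal L) φ (Icc (a / 2) b) := by
    refine (convex_Icc _ _).lipschitzOnWith_of_nnnorm_hasDerivWithin_le
      (fun t ht => (hφ t (hIcc ht)).hasDerivWithinAt) fun t ht => ?_
    rw [← NNReal.coe_le_coe, coe_nnnorm]
    exact (hL t ht).trans (Real.le_coe_toNNReal L)
  obtain ⟨ψ, hψ, hψφ⟩ := hφL.extend_real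
  have hψd : ∀ x ∈ tsupport f, ψ (d x) = φ (d x) := fun x hx =>
    (hψφ (Ioo_subset_Icc_self (hdI x hx))).symm
  obtain ⟨A, hfA⟩ := hf.lipschitzWith_of_hasCompactSupport hsupp one_ne_zero
  have hfabs : LipschitzWith A fun x => |f x| := by
    simpa [Function.comp_def] using lipschitzWith_one_norm.comp hfA
  obtain ⟨M, hM⟩ := hf.continuous.bounded_above_of_compact_support hsupp
  have hψdL : LipschitzWith (Real.toNNReal L * 1) fun x => ψ (d x) := hψ.comp hd
  obtain ⟨N, hN⟩ := hsupp.exists_bound_of_continuousOn hψdL.continuous.continuousOn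
  obtain ⟨G, hgL⟩ := hfabs.exists_lipschitzWith_mul hψdL (M := M) (N := N)
    (fun x => by simpa using hM x)
    (fun x hx => hN x (subset_tsupport _ (by simpa using hx)))
  set g : E → ℝ := fun x => |f x| * ψ (d x) with hg_def
  have hgsub : tsupport g ⊆ tsupport f := by
    refine closure_mono fun x hx => ?_
    contrapose! hx
    simp [hg_def, Function.notMem_support.1 hx]
  have hgc : HasCompactSupport g := hsupp.of_isClosed_subset (isClosed_tsupport g) hgsub
  have hg0 : ∀ x, 0 ≤ g x := fun x => by
    by_cases hx : x ∈ tsupport f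
    · exact mul_nonneg (abs_nonneg _) (by rw [hψd x hx]; exact hφ0 _ (hdc x hx))
    · simp [hg_def, image_eq_zero_of_notMem_tsupport hx]
  have hweak : ∀ v : E, 0 ≤ ∫ x, lineDeriv ℝ g x v * lineDeriv ℝ d x v ∂μ :=
    (concaveOn_infDist_frontier hΩ hconv hne).integral_lineDeriv_mul_lineDeriv_nonneg hΩ hd hgL hg0
      hgc (hgsub.trans hsuppΩ)
  let e := stdOrthonormalBasis ℝ E
  have hsum : 0 ≤ ∫ x, ∑ i, lineDeriv ℝ g x (e i) * lineDeriv ℝ d x (e i) ∂μ := by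
    rw [integral_finsetSum _ fun i _ => integrable_lineDeriv_mul_lineDeriv hd hgL hgc (e i)]
    exact Finset.sum_nonneg fun i _ => hweak (e i)
  have hf'0 : ∀ x ∉ tsupport f, fderiv ℝ f x = 0 := fun x hx => by
    by_contra h
    exact hx (support_fderiv_subset ℝ h)
  have hI1 : Integrable (fun x => ‖fderiv ℝ f x‖ * φ (d x)) μ := by
    refine integrable_of_continuousOn_tsupport hsupp ?_ fun x hx => by simp [hf'0 x hx]
    refine (hf.continuous_fderiv one_ne_zero).norm.continuousOn.mul ?_
    exact hψdL.continuous.continuousOn.congr fun x hx => (hψd x hx).symm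
  have hI2 : Integrable (fun x => |f x| * -φ' (d x)) μ := by
    refine integrable_of_continuousOn_tsupport hsupp ?_ fun x hx => by
      simp [image_eq_zero_of_notMem_tsupport hx]
    exact hf.continuous.abs.continuousOn.mul ((hφ'.comp hd.continuous.continuousOn fun x hx =>
      hIcc (Ioo_subset_Icc_self (hdI x hx))).neg)
  have hpt : ∀ᵐ x ∂μ, ∑ i, lineDeriv ℝ g x (e i) * lineDeriv ℝ d x (e i)
      ≤ ‖fderiv ℝ f x‖ * φ (d x) - |f x| * -φ' (d x) := by
    filter_upwards [hd.ae_differentiableAt, hfabs.ae_differentiableAt] with x hdx hfx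
    by_cases hx : x ∈ tsupport f
    · have hψx : HasDerivAt ψ (φ' (d x)) (d x) := by
        refine (hφ (d x) (hIcc (Ioo_subset_Icc_self (hdI x hx)))).congr_of_eventuallyEq ?_
        filter_upwards [Icc_mem_nhds (hdI x hx).1 (hdI x hx).2] with t ht using (hψφ ht).symm
      have hgx : HasFDerivAt g (|f x| • (φ' (d x) • fderiv ℝ d x)
          + ψ (d x) • fderiv ℝ (fun y => |f y|) x) x :=
        hfx.hasFDerivAt.mul (hψx.comp_hasFDerivAt x hdx.hasFDerivAt)
      have hle : ‖fderiv ℝ d x‖ ≤ 1 := norm_fderiv_le_of_lipschitz ℝ hd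
      have hge : 1 ≤ ‖fderiv ℝ d x‖ :=
        one_le_norm_fderiv_infDist_frontier hΩ hne (hsuppΩ hx) hdx
      have hone : ‖fderiv ℝ d x‖ = 1 := le_antisymm hle hge
      have hfd : DifferentiableAt ℝ f x := hf.differentiable one_ne_zero x
      have hcs : ∑ i, fderiv ℝ (fun y => |f y|) x (e i) * fderiv ℝ d x (e i)
          ≤ ‖fderiv ℝ f x‖ := by
        rw [e.sum_apply_mul_apply]
        refine (real_inner_le_norm _ _).trans ?_
        rw [LinearIsometryEquiv.norm_map, LinearIsometryEquiv.norm_map, hone, mul_one]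
        exact norm_fderiv_abs_le hfd
      have hsq : ∑ i, fderiv ℝ d x (e i) * fderiv ℝ d x (e i) = 1 := by
        rw [e.sum_apply_mul_apply, real_inner_self_eq_norm_sq, LinearIsometryEquiv.norm_map, hone,
          one_pow]
      have heq : ∑ i, lineDeriv ℝ g x (e i) * lineDeriv ℝ d x (e i)
          = |f x| * φ' (d x) * ∑ i, fderiv ℝ d x (e i) * fderiv ℝ d x (e i)
            + φ (d x) * ∑ i, fderiv ℝ (fun y => |f y|) x (e i) * fderiv ℝ d x (e i) := by
        rw [Finset.mul_sum, Finset.mul_sum, ← Finset.sum_add_distrib]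
        refine Finset.sum_congr rfl fun i _ => ?_
        rw [(hgx.hasLineDerivAt (e i)).lineDeriv, (hdx.hasFDerivAt.hasLineDerivAt (e i)).lineDeriv,
          hψd x hx]
        simp only [add_apply, smul_apply, smul_eq_mul]
        ring
      rw [heq, hsq]
      have := mul_le_mul_of_nonneg_left hcs (hφ0 _ (hdc x hx))
      linarith
    · simp [hf'0 x hx, image_eq_zero_of_notMem_tsupport hx,
        lineDeriv_eq_zero_of_notMem_tsupport (fun h => hx (hgsub h))]
  have hmono := integral_mono_ae
    (integrable_finsetSum _ fun i _ => integrable_lineDeriv_mul_lineDeriv hd hgL hgc (e i))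
    (hI1.sub hI2) hpt
  rw [integral_sub' hI1 hI2] at hmono
  rw [setIntegral_eq_integral_of_forall_compl_eq_zero fun x hx => by
      simp [image_eq_zero_of_notMem_tsupport (fun h => hx (hsuppΩ h))],
    setIntegral_eq_integral_of_forall_compl_eq_zero fun x hx => by
      simp [hf'0 x (fun h => hx (hsuppΩ h))]]
  linarith

end Integral

section PowerSeries

variable {a : ℕ → ℝ}

lemma summable_succ_mul_succ_coeff (ha : ∀ r : ℝ, 0 ≤ r → Summable fun k => |a k| * r ^ k)
    {r : ℝ} (hr : 0 ≤ r) : Summable fun k : ℕ => |(k + 1) * a (k + 1)| * r ^ k := by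
  refine Summable.of_nonneg_of_le (fun k => by positivity) (fun k => ?_)
    ((summable_nat_add_iff 1).2 (ha (2 * (r + 1)) (by positivity)))
  have h2 : (k + 1 : ℝ) ≤ 2 ^ (k + 1) := by
    exact_mod_cast (Nat.lt_two_pow_self (n := k + 1)).le
  have h3 : r ^ k ≤ (r + 1) ^ (k + 1) :=
    (pow_le_pow_left₀ hr (by linarith) k).trans (pow_le_pow_right₀ (by linarith) k.le_succ)
  rw [abs_mul, abs_of_nonneg (by positivity : (0 : ℝ) ≤ k + 1), mul_pow]
  calc (k + 1 : ℝ) * |a (k + 1)| * r ^ k = |a (k + 1)| * ((k + 1) * r ^ k) := by ring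
    _ ≤ _ := by gcongr

lemma summable_mul_pow (ha : ∀ r : ℝ, 0 ≤ r → Summable fun k => |a k| * r ^ k) (w : ℝ) :
    Summable fun k => a k * w ^ k :=
  Summable.of_norm (by simpa [abs_mul] using ha |w| (abs_nonneg w))

lemma hasDerivAt_tsum_mul_pow (ha : ∀ r : ℝ, 0 ≤ r → Summable fun k => |a k| * r ^ k) (w : ℝ) :
    HasDerivAt (fun w => ∑' k, a k * w ^ k) (∑' k : ℕ, ((k + 1) * a (k + 1)) * w ^ k) w := by
  have hu : Summable fun k : ℕ => |a k| * (k * (|w| + 1) ^ (k - 1)) := by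
    rw [← summable_nat_add_iff 1]
    refine (summable_succ_mul_succ_coeff ha (r := |w| + 1) (by positivity)).congr fun k => ?_
    rw [abs_mul, abs_of_nonneg (by positivity : (0 : ℝ) ≤ k + 1)]
    push_cast
    ring
  have hb : ∀ k : ℕ, ∀ y ∈ Metric.ball (0 : ℝ) (|w| + 1),
      ‖a k * (k * y ^ (k - 1))‖ ≤ |a k| * (k * (|w| + 1) ^ (k - 1)) := by
    intro k y hy
    rw [norm_mul, norm_mul, norm_pow, Real.norm_natCast, Real.norm_eq_abs]
    gcongr
    exact (mem_ball_zero_iff.1 hy).le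
  have hw : w ∈ Metric.ball (0 : ℝ) (|w| + 1) := by simp
  have h := hasDerivAt_tsum_of_isPreconnected hu Metric.isOpen_ball
    (convex_ball (0 : ℝ) (|w| + 1)).isPreconnected
    (fun k y _ => (hasDerivAt_pow k y).const_mul (a k)) hb hw (summable_mul_pow ha w) hw
  refine h.congr_deriv ?_
  have hs : Summable fun k : ℕ => a k * (k * w ^ (k - 1)) :=
    Summable.of_norm_bounded hu fun k => hb k w hw
  rw [hs.tsum_eq_zero_add]
  simp only [CharP.cast_eq_zero, zero_mul, mul_zero, zero_add, add_tsub_cancel_right]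
  refine tsum_congr fun k => ?_
  push_cast
  ring

end PowerSeries

section Bessel

variable {ν : ℝ}

/-- Taylor coefficients of the entire function `G` with `J_ν(x) = x ^ ν * G(x ^ 2)`. -/
noncomputable def besselCoeff (ν : ℝ) (k : ℕ) : ℝ :=
  (-1) ^ k / (2 ^ (2 * (k : ℝ) + ν) * (Nat.factorial k : ℝ) * Real.Gamma ((k : ℝ) + 1 + ν))

lemma besselCoeff_zero_pos (hν : 0 < ν) : 0 < besselCoeff ν 0 := by
  have := Real.Gamma_pos_of_pos (show 0 < 1 + ν by linarith)
  simp only [besselCoeff, pow_zero, CharP.cast_eq_zero, mul_zero, zero_add, Nat.factorial_zero,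
    Nat.cast_one, mul_one]
  positivity

lemma besselCoeff_succ (hν : 0 < ν) (k : ℕ) :
    4 * ((k + 1) * (k + 1 + ν) * besselCoeff ν (k + 1)) = -besselCoeff ν k := by
  have hpos : 0 < (k : ℝ) + 1 + ν := by positivity
  have hΓ := Real.Gamma_pos_of_pos hpos
  have h2 : (2 : ℝ) ^ (2 * ((k + 1 : ℕ) : ℝ) + ν) = 4 * 2 ^ (2 * (k : ℝ) + ν) := by
    rw [show 2 * ((k + 1 : ℕ) : ℝ) + ν = (2 : ℕ) + (2 * (k : ℝ) + ν) by push_cast; ring,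
      Real.rpow_add two_pos, Real.rpow_natCast]
    norm_num
  have hG : Real.Gamma (((k + 1 : ℕ) : ℝ) + 1 + ν) = (k + 1 + ν) * Real.Gamma (k + 1 + ν) := by
    rw [← Real.Gamma_add_one hpos.ne']
    push_cast
    ring_nf
  have h2p : (0 : ℝ) < 2 ^ (2 * (k : ℝ) + ν) := by positivity
  rw [besselCoeff, besselCoeff, h2, hG, Nat.factorial_succ, pow_succ]
  push_cast
  field_simp

lemma abs_besselCoeff_le (hν : 0 < ν) (k : ℕ) :
    |besselCoeff ν k| ≤ |besselCoeff ν 0| / (Nat.factorial k : ℝ) := by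
  induction k with
  | zero => simp
  | succ k ih =>
    have h := congrArg abs (besselCoeff_succ hν k)
    rw [abs_neg, abs_mul, abs_mul, abs_of_pos (by positivity : (0 : ℝ) < 4),
      abs_of_pos (by positivity : (0 : ℝ) < (k + 1) * (k + 1 + ν))] at h
    rw [le_div_iff₀ (by positivity)] at ih ⊢
    rw [Nat.factorial_succ]
    push_cast
    refine le_trans ?_ ih
    rw [← h]
    have h1 : (k + 1 : ℝ) ≤ 4 * ((k + 1) * (k + 1 + ν)) := by
      nlinarith [(Nat.cast_nonneg k : (0 : ℝ) ≤ k)]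
    calc |besselCoeff ν (k + 1)| * ((k + 1) * (Nat.factorial k : ℝ))
        = (k + 1) * (|besselCoeff ν (k + 1)| * (Nat.factorial k : ℝ)) := by ring
      _ ≤ (4 * ((k + 1) * (k + 1 + ν))) * (|besselCoeff ν (k + 1)| * (Nat.factorial k : ℝ)) := by
        gcongr
      _ = _ := by ring

lemma summable_besselCoeff (hν : 0 < ν) {r : ℝ} (hr : 0 ≤ r) :
    Summable fun k => |besselCoeff ν k| * r ^ k := by
  refine Summable.of_nonneg_of_le (fun k => by positivity) (fun k => ?_)
    ((Real.summable_pow_div_factorial r).mul_left |besselCoeff ν 0|)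
  calc |besselCoeff ν k| * r ^ k ≤ |besselCoeff ν 0| / (Nat.factorial k : ℝ) * r ^ k := by
        gcongr
        exact abs_besselCoeff_le hν k
    _ = _ := by ring

lemma besselJ_eq_rpow_mul_tsum {x : ℝ} (hx : 0 < x) :
    besselJ ν x = x ^ ν * ∑' k, besselCoeff ν k * (x ^ 2) ^ k := by
  rw [besselJ, ← tsum_mul_left]
  refine tsum_congr fun k => ?_
  have : x ^ (2 * (k : ℝ) + ν) = (x ^ 2) ^ k * x ^ ν := by
    rw [Real.rpow_add hx, ← pow_mul, ← Real.rpow_natCast]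
    push_cast
    rfl
  rw [this, besselCoeff]
  ring

/-- The entire function `G` with `J_ν(x) = x ^ ν * G(x ^ 2)` and the equation it satisfies. -/
lemma exists_besselJ_eq_rpow_mul (hν : 0 < ν) : ∃ G G' G'' : ℝ → ℝ,
    (∀ x, 0 < x → besselJ ν x = x ^ ν * G (x ^ 2)) ∧ 0 < G 0 ∧
    (∀ w, HasDerivAt G (G' w) w) ∧ (∀ w, HasDerivAt G' (G'' w) w) ∧
    ∀ w, 4 * (w * G'' w + (ν + 1) * G' w) = -G w := by
  have ha : ∀ r : ℝ, 0 ≤ r → Summable fun k => |besselCoeff ν k| * r ^ k :=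
    fun r hr => summable_besselCoeff hν hr
  have ha' : ∀ r : ℝ, 0 ≤ r → Summable fun k : ℕ => |(k + 1) * besselCoeff ν (k + 1)| * r ^ k :=
    fun r hr => summable_succ_mul_succ_coeff ha hr
  have ha'' : ∀ r : ℝ, 0 ≤ r → Summable fun k : ℕ =>
      |(k + 1) * (((k + 1 : ℕ) + 1) * besselCoeff ν (k + 1 + 1))| * r ^ k :=
    fun r hr => summable_succ_mul_succ_coeff ha' hr
  refine ⟨_, _, _, fun x hx => besselJ_eq_rpow_mul_tsum hx, ?_,
    fun w => hasDerivAt_tsum_mul_pow ha w, fun w => hasDerivAt_tsum_mul_pow ha' w, fun w => ?_⟩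
  · rw [tsum_eq_single 0 fun k hk => by simp [hk]]
    simpa using besselCoeff_zero_pos hν
  · have hs' := summable_mul_pow ha' w
    have hs'' := summable_mul_pow ha'' w
    have hs3 : Summable fun k : ℕ => (k * ((k + 1) * besselCoeff ν (k + 1))) * w ^ k := by
      rw [← summable_nat_add_iff 1]
      refine (hs''.mul_left w).congr fun k => ?_
      push_cast
      ring
    have hwG : w * ∑' k : ℕ, (k + 1) * (((k + 1 : ℕ) + 1) * besselCoeff ν (k + 1 + 1)) * w ^ k
        = ∑' k : ℕ, (k * ((k + 1) * besselCoeff ν (k + 1))) * w ^ k := by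
      rw [← tsum_mul_left, hs3.tsum_eq_zero_add]
      simp only [CharP.cast_eq_zero, zero_mul, zero_add]
      refine tsum_congr fun k => ?_
      push_cast
      ring
    rw [hwG, ← tsum_mul_left, ← hs3.tsum_add (hs'.mul_left _), ← tsum_mul_left, ← tsum_neg]
    refine tsum_congr fun k => ?_
    rw [← neg_mul, ← besselCoeff_succ hν k]
    ring

/-- The logarithmic derivative `P(x ^ 2) = x * deriv J_ν x / J_ν x`, its Riccati equation, and its
monotonicity below the first zero of `J_ν`. -/
lemma exists_bessel_logDeriv (hν : 0 < ν) {j z : ℝ} (hJ : ∀ t ∈ Ioo 0 j, 0 < besselJ ν t)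
    (hz : z ∈ Ioo 0 j) : ∃ P : ℝ → ℝ,
    (∀ w ∈ Ioo 0 (j ^ 2), HasDerivAt P ((ν ^ 2 - w - P w ^ 2) / (2 * w)) w) ∧
    (∀ w ∈ Ioc 0 (z ^ 2), P (z ^ 2) ≤ P w ∧ P w ≤ ν) ∧
    z * deriv (besselJ ν) z = P (z ^ 2) * besselJ ν z := by
  obtain ⟨G, G', G'', hJG, hG0, hG, hG', hode⟩ := exists_besselJ_eq_rpow_mul hν
  have hj : 0 < j := hz.1.trans hz.2
  have hGpos : ∀ w ∈ Ico 0 (j ^ 2), 0 < G w := by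
    intro w hw
    rcases hw.1.eq_or_lt with h | h
    · rwa [← h]
    · have hs : √w ∈ Ioo 0 j := ⟨Real.sqrt_pos.2 h, (Real.sqrt_lt' hj).2 hw.2⟩
      have := hJ _ hs
      rw [hJG _ hs.1, Real.sq_sqrt hw.1] at this
      exact pos_of_mul_pos_right this (by positivity)
  -- the derivative of `w ^ (1 + ν) * K` is `w ^ ν * G ^ 2`
  let K : ℝ → ℝ := fun w => 4 * w * G' w ^ 2 + 4 * ν * (G w * G' w) + G w ^ 2
  have hK : ∀ w, 0 < w → HasDerivAt (fun w => w ^ (1 + ν) * K w) (w ^ ν * G w ^ 2) w := by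
    intro w hw
    have h1 : HasDerivAt K (4 * G' w ^ 2 + 4 * w * (2 * G' w * G'' w)
        + 4 * ν * (G' w * G' w + G w * G'' w) + 2 * G w * G' w) w := by
      have := ((((hasDerivAt_id w).const_mul 4).mul ((hG' w).pow 2)).add
        (((hG w).mul (hG' w)).const_mul (4 * ν))).add ((hG w).pow 2)
      refine this.congr_deriv ?_
      simp only [id, Pi.pow_apply, Nat.cast_ofNat]
      ring
    have h2 := (Real.hasDerivAt_rpow_const (p := 1 + ν) (Or.inl hw.ne')).mul h1
    refine h2.congr_deriv ?_
    have h3 : w ^ (1 + ν) = w * w ^ ν := by rw [Real.rpow_add hw, Real.rpow_one]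
    have h4 : (1 + ν - 1) = ν := by ring
    rw [h3, h4]
    have h5 := hode w
    simp only [K]
    linear_combination (w ^ ν * (2 * w * G' w + ν * G w)) * h5
  have hGc : Continuous G := continuous_iff_continuousAt.2 fun w => (hG w).continuousAt
  have hG'c : Continuous G' := continuous_iff_continuousAt.2 fun w => (hG' w).continuousAt
  have hKmono : MonotoneOn (fun w => w ^ (1 + ν) * K w) (Ici 0) := by
    refine monotoneOn_of_hasDerivWithinAt_nonneg (convex_Ici 0) ?_
      (fun w hw => (hK w (by simpa using hw)).hasDerivWithinAt) fun w hw => ?_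
    · have : Continuous fun w : ℝ => w ^ (1 + ν) := Real.continuous_rpow_const (by linarith)
      exact Continuous.continuousOn (by fun_prop)
    · rw [interior_Ici] at hw
      have := Real.rpow_nonneg (le_of_lt hw) ν
      positivity
  have hK0 : ∀ w, 0 < w → 0 ≤ K w := by
    intro w hw
    have := hKmono (show (0 : ℝ) ∈ Ici 0 by simp) hw.le hw.le
    simp only [Real.zero_rpow (by linarith : 1 + ν ≠ 0), zero_mul] at this
    exact nonneg_of_mul_nonneg_right this (by positivity)
  let P : ℝ → ℝ := fun w => ν + 2 * w * G' w / G w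
  have hP : ∀ w ∈ Ico 0 (j ^ 2),
      HasDerivAt P (-K w / (2 * G w ^ 2)) w := by
    intro w hw
    have hg := hGpos w hw
    have := ((((hasDerivAt_id w).const_mul 2).mul (hG' w)).div (hG w) hg.ne').const_add ν
    refine this.congr_deriv ?_
    have h5 := hode w
    simp only [K, id, Pi.mul_apply]
    field_simp
    linear_combination G w * h5
  refine ⟨P, fun w hw => ?_, ?_, ?_⟩
  · have hg := hGpos w ⟨hw.1.le, hw.2⟩
    have hw0 := hw.1
    refine (hP w ⟨hw.1.le, hw.2⟩).congr_deriv ?_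
    simp only [K, P]
    field_simp
    ring
  · have hz2 : z ^ 2 < j ^ 2 := pow_lt_pow_left₀ hz.2 hz.1.le two_ne_zero
    have hanti : AntitoneOn P (Icc 0 (z ^ 2)) := by
      refine antitoneOn_of_hasDerivWithinAt_nonpos (convex_Icc _ _)
        (fun w hw => (hP w ⟨hw.1, hw.2.trans_lt hz2⟩).continuousAt.continuousWithinAt)
        (fun w hw => ?_) (fun w hw => ?_) (f' := fun w => -K w / (2 * G w ^ 2))
      · rw [interior_Icc] at hw
        exact (hP w ⟨hw.1.le, hw.2.trans hz2⟩).hasDerivWithinAt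
      · rw [interior_Icc] at hw
        exact div_nonpos_of_nonpos_of_nonneg (neg_nonpos.2 (hK0 w hw.1)) (by positivity)
    intro w hw
    refine ⟨hanti ⟨hw.1.le, hw.2⟩ ⟨by positivity, le_rfl⟩ hw.2, ?_⟩
    have := hanti ⟨le_rfl, by positivity⟩ ⟨hw.1.le, hw.2⟩ hw.1.le
    simpa [P] using this
  · have hz0 := hz.1
    have hg : 0 < G (z ^ 2) := hGpos _ ⟨by positivity, pow_lt_pow_left₀ hz.2 hz.1.le two_ne_zero⟩
    have hder : HasDerivAt (fun x => x ^ ν * G (x ^ 2))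
        (ν * z ^ (ν - 1) * G (z ^ 2) + z ^ ν * (G' (z ^ 2) * (2 * z))) z := by
      have h2 : HasDerivAt (fun x : ℝ => G (x ^ 2)) (G' (z ^ 2) * (2 * z)) z := by
        refine ((hG (z ^ 2)).comp z (hasDerivAt_pow 2 z)).congr_deriv ?_
        simp
      exact (Real.hasDerivAt_rpow_const (Or.inl hz0.ne')).mul h2
    have heq : besselJ ν =ᶠ[nhds z] fun x => x ^ ν * G (x ^ 2) := by
      filter_upwards [lt_mem_nhds hz0] with x hx using hJG x hx
    rw [heq.deriv_eq, hder.deriv, hJG z hz0, Real.rpow_sub_one hz0.ne']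
    simp only [P]
    field_simp

end Bessel

/-- The radial weight producing the Bessel-type Hardy inequality. -/
lemma exists_hardy_profile {m ν lam c jν δ₀ : ℝ} (hδ₀ : 0 < δ₀) (hm : 1 < m)
    (hν : ν ∈ Ioc 0 (1 / m)) (hlam : lam ∈ Ico 0 ((1 + ν * m) / 2)) (hc : 0 < c)
    (hJ : ∀ t ∈ Ioo 0 jν, 0 < besselJ ν t) (hcm : 2 * c / m ∈ Ioo 0 jν)
    (hroot : (1 - 2 * lam) * besselJ ν (2 * c / m)
      + 2 * c * deriv (besselJ ν) (2 * c / m) = 0) :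
    ∃ (R : ℝ) (φ φ' : ℝ → ℝ), δ₀ < R ∧ (∀ t ∈ Ioo 0 R, HasDerivAt φ (φ' t) t) ∧
      ContinuousOn φ' (Ioo 0 R) ∧
      ∀ t ∈ Ioc 0 δ₀, 0 ≤ φ t ∧ φ t ≤ ((1 + ν * m) / 2 - lam ^ 2) / t ∧
        (1 - ν ^ 2 * m ^ 2) / 4 / t ^ 2
          + (c ^ 2 + (m - 1) * (lam - lam ^ 2)) / δ₀ ^ m / t ^ (2 - m) ≤ -φ' t := by
  have hm0 : 0 < m := by linarith
  obtain ⟨P, hP, hPb, hPz⟩ := exists_bessel_logDeriv hν.1 hJ hcm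
  have hJz := hJ _ hcm
  set z := 2 * c / m with hz
  have hz0 : 0 < z := hcm.1
  have hcz : c = m * z / 2 := by rw [hz]; field_simp
  have hPlam : m * P (z ^ 2) = 2 * lam - 1 := by
    refine mul_right_cancel₀ hJz.ne' ?_
    rw [mul_assoc, ← hPz]
    rw [hcz] at hroot
    linear_combination hroot
  have hνm : ν * m ≤ 1 := by
    have := hν.2
    rwa [le_div_iff₀ hm0] at this
  have hlam1 : lam ≤ 1 := by linarith [hlam.2]
  have hlamsq : 0 ≤ lam - lam ^ 2 := by nlinarith [hlam.1]
  let w : ℝ → ℝ := fun t => z ^ 2 * (t / δ₀) ^ m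
  let U : ℝ → ℝ := fun t => 1 / 2 + m / 2 * P (w t)
  let φ' : ℝ → ℝ := fun t => (lam ^ 2 - U t ^ 2 - (1 - ν ^ 2 * m ^ 2) / 4) / t ^ 2
    - (c ^ 2 + (m - 1) * (lam - lam ^ 2)) / δ₀ ^ m / t ^ (2 - m)
  let φ : ℝ → ℝ := fun t => (U t - lam ^ 2) / t - (lam - lam ^ 2) / δ₀ ^ m * t ^ (m - 1)
  have hjz : 1 < jν / z := (one_lt_div hz0).2 hcm.2
  have hjpos : 0 < jν := hz0.trans hcm.2
  have hwmem : ∀ t ∈ Ioo 0 (δ₀ * (jν / z) ^ (2 / m)), w t ∈ Ioo 0 (jν ^ 2) := by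
    intro t ht
    have ht0 := ht.1
    refine ⟨by positivity, ?_⟩
    have h1 : (t / δ₀) ^ m < ((jν / z) ^ (2 / m)) ^ m := by
      refine Real.rpow_lt_rpow (by positivity) ?_ hm0
      rw [div_lt_iff₀ hδ₀, mul_comm]
      exact ht.2
    rw [← Real.rpow_mul (by positivity), div_mul_cancel₀ _ hm0.ne'] at h1
    calc w t < z ^ 2 * (jν / z) ^ (2 : ℝ) := by
          exact mul_lt_mul_of_pos_left h1 (by positivity)
      _ = jν ^ 2 := by
        rw [Real.rpow_two]
        field_simp
  have hU : ∀ t ∈ Ioo 0 (δ₀ * (jν / z) ^ (2 / m)),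
      HasDerivAt U (m ^ 2 / 4 * (ν ^ 2 - w t - P (w t) ^ 2) / t) t := by
    intro t ht
    have ht0 := ht.1
    have hw : HasDerivAt w (m * w t / t) t := by
      have h1 := (((hasDerivAt_id t).div_const δ₀).rpow_const (p := m)
        (Or.inl (by simp only [id]; positivity))).const_mul (z ^ 2)
      refine h1.congr_deriv ?_
      simp only [w, id]
      rw [Real.rpow_sub_one (by positivity)]
      field_simp
    have hwpos := (hwmem t ht).1
    refine (((hP (w t) (hwmem t ht)).comp t hw).const_mul (m / 2)).const_add (1 / 2)
      |>.congr_deriv ?_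
    field_simp
    ring
  have htm : ∀ t : ℝ, 0 < t → t ^ (m - 1) = t ^ m / t := fun t ht => Real.rpow_sub_one ht.ne' m
  have htm2 : ∀ t : ℝ, 0 < t → t ^ (2 - m) = t ^ 2 / t ^ m := fun t ht => by
    rw [Real.rpow_sub ht, Real.rpow_two]
  refine ⟨δ₀ * (jν / z) ^ (2 / m), φ, φ', ?_, ?_, ?_, ?_⟩
  · exact lt_mul_of_one_lt_right hδ₀ (Real.one_lt_rpow hjz (by positivity))
  · intro t ht
    have ht0 := ht.1
    have h1 := (((hU t ht).sub_const (lam ^ 2)).div (hasDerivAt_id t) ht0.ne').sub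
      ((Real.hasDerivAt_rpow_const (p := m - 1) (Or.inl ht0.ne')).const_mul
        ((lam - lam ^ 2) / δ₀ ^ m))
    refine h1.congr_deriv ?_
    have h2 : t ^ (m - 1 - 1) = t ^ m / t / t := by
      rw [Real.rpow_sub_one ht0.ne', Real.rpow_sub_one ht0.ne']
    have htmpos : 0 < t ^ m := by positivity
    have hδm : 0 < δ₀ ^ m := by positivity
    have hwt : w t = z ^ 2 * (t ^ m / δ₀ ^ m) := by
      simp only [w]
      rw [Real.div_rpow ht0.le hδ₀.le]
    simp only [φ', U, id]
    rw [h2, htm2 t ht0, hcz]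
    generalize hp : P (w t) = p
    rw [hwt]
    field_simp
    ring
  · intro t ht
    have ht0 := ht.1
    have hUc := (hU t ht).continuousAt
    have h1 : ContinuousAt (fun t : ℝ => t ^ (2 - m)) t :=
      Real.continuousAt_rpow_const _ _ (Or.inl ht0.ne')
    have h2 : t ^ (2 - m) ≠ 0 := by positivity
    have h3 : t ^ 2 ≠ 0 := by positivity
    refine ContinuousAt.continuousWithinAt ?_
    exact ((continuousAt_const.sub (hUc.pow 2)).sub continuousAt_const |>.div
      (continuousAt_id.pow 2) h3).sub (continuousAt_const.div h1 h2)
  · intro t ht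
    have ht0 := ht.1
    have hle1 : (t / δ₀) ^ m ≤ 1 :=
      Real.rpow_le_one (by positivity) ((div_le_one hδ₀).2 ht.2) hm0.le
    have hwt : w t ∈ Ioc 0 (z ^ 2) :=
      ⟨by positivity, mul_le_of_le_one_right (by positivity) hle1⟩
    obtain ⟨hlow, hupp⟩ := hPb _ hwt
    have hUlow : lam ≤ U t := by
      have := mul_le_mul_of_nonneg_left hlow hm0.le
      simp only [U]
      linarith
    have hUupp : U t ≤ (1 + ν * m) / 2 := by
      have := mul_le_mul_of_nonneg_left hupp hm0.le
      simp only [U]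
      linarith
    have hφ : φ t = (U t - lam ^ 2 - (lam - lam ^ 2) * (t / δ₀) ^ m) / t := by
      simp only [φ]
      rw [htm t ht0, Real.div_rpow ht0.le hδ₀.le]
      ring
    have hmul : (lam - lam ^ 2) * (t / δ₀) ^ m ≤ lam - lam ^ 2 :=
      mul_le_of_le_one_right hlamsq hle1
    have hmul0 : 0 ≤ (lam - lam ^ 2) * (t / δ₀) ^ m := by positivity
    refine ⟨?_, ?_, ?_⟩
    · rw [hφ]
      exact div_nonneg (by linarith) ht0.le
    · rw [hφ]
      exact div_le_div_of_nonneg_right (by linarith) ht0.le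
    · have hsq : 0 ≤ (U t ^ 2 - lam ^ 2) / t ^ 2 :=
        div_nonneg (by nlinarith [hlam.1]) (by positivity)
      simp only [φ']
      have : (lam ^ 2 - U t ^ 2 - (1 - ν ^ 2 * m ^ 2) / 4) / t ^ 2
          = -((U t ^ 2 - lam ^ 2) / t ^ 2) - (1 - ν ^ 2 * m ^ 2) / 4 / t ^ 2 := by ring
      linarith

theorem stmt_17 (n : ℕ) (Ω : Set (EuclideanSpace ℝ (Fin n)))
    (hΩo : IsOpen Ω) (hΩconv : Convex ℝ Ω) (hΩne : Ω.Nonempty) (hΩproper : Ω ≠ Set.univ)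
    (δ₀ : ℝ) (hδ₀ : IsLUB ((fun x => Metric.infDist x (frontier Ω)) '' Ω) δ₀)
    (m ν lam c jν : ℝ)
    (hm : 1 < m) (hν : ν ∈ Set.Ioc 0 (1 / m))
    (hlam : lam ∈ Set.Ico 0 ((1 + ν * m) / 2))
    (hc : 0 < c)
    (hjν_pos : 0 < jν) (hjν_zero : besselJ ν jν = 0)
    (hjν_first : ∀ t ∈ Set.Ioo 0 jν, 0 < besselJ ν t)
    (hcm : 2 * c / m ∈ Set.Ioo 0 jν)
    (hroot : (1 - 2 * lam) * besselJ ν (2 * c / m)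
      + 2 * c * deriv (besselJ ν) (2 * c / m) = 0)
    (f : EuclideanSpace ℝ (Fin n) → ℝ)
    (hf : ContDiff ℝ 1 f) (hsupp : HasCompactSupport f) (hsuppΩ : tsupport f ⊆ Ω)
    (hL1 : IntegrableOn (fun x => ‖fderiv ℝ f x‖ / Metric.infDist x (frontier Ω)) Ω) :
    (1 - ν ^ 2 * m ^ 2) / 4 * (∫ x in Ω, |f x| / (Metric.infDist x (frontier Ω)) ^ 2)
      + (c ^ 2 + (m - 1) * (lam - lam ^ 2)) / δ₀ ^ m *
        (∫ x in Ω, |f x| / (Metric.infDist x (frontier Ω)) ^ ((2:ℝ) - m))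
    ≤ ((1 + ν * m) / 2 - lam ^ 2) *
        (∫ x in Ω, ‖fderiv ℝ f x‖ / Metric.infDist x (frontier Ω)) := by
  have hpos : ∀ x ∈ Ω, 0 < Metric.infDist x (frontier Ω) :=
    fun x hx => infDist_frontier_pos hΩo hΩproper hx
  have hδ : ∀ x ∈ Ω, Metric.infDist x (frontier Ω) ≤ δ₀ :=
    fun x hx => hδ₀.1 (mem_image_of_mem _ hx)
  obtain ⟨x₀, hx₀⟩ := hΩne
  have hδ₀pos : 0 < δ₀ := (hpos x₀ hx₀).trans_le (hδ x₀ hx₀)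
  obtain ⟨R, φ, φ', hR, hφ, hφ', hbd⟩ :=
    exists_hardy_profile hδ₀pos hm hν hlam hc hjν_first hcm hroot
  have hdist : Continuous fun x : EuclideanSpace ℝ (Fin n) => Metric.infDist x (frontier Ω) :=
    Metric.continuous_infDist_pt _
  have hmem : ∀ x ∈ Ω, Metric.infDist x (frontier Ω) ∈ Ioc 0 δ₀ :=
    fun x hx => ⟨hpos x hx, hδ x hx⟩
  have hmemR : MapsTo (fun x => Metric.infDist x (frontier Ω)) (tsupport f) (Ioo 0 R) :=
    fun x hx => ⟨hpos x (hsuppΩ hx), (hδ x (hsuppΩ hx)).trans_lt hR⟩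
  have hf0 : ∀ x ∉ tsupport f, f x = 0 := fun x hx => image_eq_zero_of_notMem_tsupport hx
  have hf'0 : ∀ x ∉ tsupport f, fderiv ℝ f x = 0 := fun x hx => by
    by_contra h
    exact hx (support_fderiv_subset ℝ h)
  have hardy := integral_abs_mul_neg_deriv_le (μ := volume) hΩo hΩconv hΩproper hδ hR hφ hφ'
    (fun t ht => (hbd t ht).1) hf hsupp hsuppΩ
  have hI1 : Integrable fun x => |f x| / Metric.infDist x (frontier Ω) ^ 2 := by
    refine integrable_of_continuousOn_tsupport hsupp ?_ fun x hx => by simp [hf0 x hx]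
    exact hf.continuous.abs.continuousOn.div (hdist.pow 2).continuousOn
      fun x hx => (pow_pos (hmemR hx).1 2).ne'
  have hI2 : Integrable fun x => |f x| / Metric.infDist x (frontier Ω) ^ (2 - m) := by
    refine integrable_of_continuousOn_tsupport hsupp ?_ fun x hx => by simp [hf0 x hx]
    exact hf.continuous.abs.continuousOn.div
      (hdist.continuousOn.rpow_const fun x hx => Or.inl (hmemR hx).1.ne')
      fun x hx => (Real.rpow_pos_of_pos (hmemR hx).1 _).ne'
  have hI3 : Integrable fun x => |f x| * -φ' (Metric.infDist x (frontier Ω)) := by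
    refine integrable_of_continuousOn_tsupport hsupp ?_ fun x hx => by simp [hf0 x hx]
    exact hf.continuous.abs.continuousOn.mul (hφ'.comp hdist.continuousOn hmemR).neg
  have hI4 : Integrable fun x => ‖fderiv ℝ f x‖ * φ (Metric.infDist x (frontier Ω)) := by
    refine integrable_of_continuousOn_tsupport hsupp ?_ fun x hx => by simp [hf'0 x hx]
    have hφc : ContinuousOn φ (Ioo 0 R) := fun t ht => (hφ t ht).continuousAt.continuousWithinAt
    exact (hf.continuous_fderiv one_ne_zero).norm.continuousOn.mul
      (hφc.comp hdist.continuousOn hmemR)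
  have hlower : (1 - ν ^ 2 * m ^ 2) / 4 * (∫ x in Ω, |f x| / (Metric.infDist x (frontier Ω)) ^ 2)
      + (c ^ 2 + (m - 1) * (lam - lam ^ 2)) / δ₀ ^ m *
        (∫ x in Ω, |f x| / (Metric.infDist x (frontier Ω)) ^ ((2 : ℝ) - m))
      ≤ ∫ x in Ω, |f x| * -φ' (Metric.infDist x (frontier Ω)) := by
    rw [← integral_const_mul, ← integral_const_mul,
      ← integral_add (hI1.integrableOn.const_mul _) (hI2.integrableOn.const_mul _)]
    refine setIntegral_mono_on
      ((hI1.integrableOn.const_mul _).add (hI2.integrableOn.const_mul _)) hI3.integrableOn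
      hΩo.measurableSet fun x hx => ?_
    calc _ = |f x| * ((1 - ν ^ 2 * m ^ 2) / 4 / Metric.infDist x (frontier Ω) ^ 2
          + (c ^ 2 + (m - 1) * (lam - lam ^ 2)) / δ₀ ^ m
            / Metric.infDist x (frontier Ω) ^ (2 - m)) := by ring
      _ ≤ _ := mul_le_mul_of_nonneg_left (hbd _ (hmem x hx)).2.2 (abs_nonneg _)
  have hupper : ∫ x in Ω, ‖fderiv ℝ f x‖ * φ (Metric.infDist x (frontier Ω))
      ≤ ((1 + ν * m) / 2 - lam ^ 2) *
        (∫ x in Ω, ‖fderiv ℝ f x‖ / Metric.infDist x (frontier Ω)) := by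
    rw [← integral_const_mul]
    refine setIntegral_mono_on hI4.integrableOn (hL1.const_mul _) hΩo.measurableSet fun x hx => ?_
    calc _ ≤ ‖fderiv ℝ f x‖ * (((1 + ν * m) / 2 - lam ^ 2) / Metric.infDist x (frontier Ω)) :=
          mul_le_mul_of_nonneg_left (hbd _ (hmem x hx)).2.1 (norm_nonneg _)
      _ = _ := by ring
  exact hlower.trans (hardy.trans hupper)
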